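/- arXiv:1805.04137 — 2 statements merged into one kernel-verified Lean document; each statement's English description precedes it below -/
import Mathlib

section
/- Let p be a prime and let V ⊆ ℂ^ℕ be a finite-dimensional ℂ-subspace that is spanned by its integer points, i.e., V is the ℂ-span of V ∩ ℤ^ℕ. Let V_p ⊆ 𝔽_p^ℕ denote the image of V ∩ ℤ^ℕ under coordinatewise reduction modulo p. Then dim_{𝔽_p} V_p = dim_ℂ V. -/
/-- Coordinatewise image in `R` of an integer-valued function, as a `ℤ`-linear map. -/
def intCastFun (R : Type*) [Ring R] (α : Type*) : (α → ℤ) →ₗ[ℤ] (α → R) :=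
  (Int.castAddHom R).toIntLinearMap.compLeft α

@[simp]
lemma intCastFun_apply {R : Type*} [Ring R] {α : Type*} (f : α → ℤ) (a : α) :
    intCastFun R α f a = (f a : R) := rfl

/-- The `ℤ`-module of integer points of a subspace of a function space. -/
def integerPoints {K : Type*} [Field K] {α : Type*} (V : Submodule K (α → K)) :
    Submodule ℤ (α → ℤ) :=
  (V.restrictScalars ℤ).comap (intCastFun K α)

lemma mem_integerPoints {K : Type*} [Field K] {α : Type*} {V : Submodule K (α → K)}
    {f : α → ℤ} : f ∈ integerPoints V ↔ intCastFun K α f ∈ V := Iff.rfl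

/-- Integer points are closed under division by nonzero integers. -/
lemma mem_integerPoints_of_smul_mem {K : Type*} [Field K] [CharZero K] {α : Type*}
    {V : Submodule K (α → K)} {m : ℤ} (hm : m ≠ 0) {f : α → ℤ}
    (h : m • f ∈ integerPoints V) : f ∈ integerPoints V := by
  rw [mem_integerPoints, map_smul, ← Int.cast_smul_eq_zsmul K] at h
  exact (V.smul_mem_iff (Int.cast_ne_zero.mpr hm)).mp h

/-- A finite-dimensional space of sequences embeds into finitely many coordinates. -/
lemma exists_forall_lt_eq_zero_imp_eq_zero {K : Type*} [Field K] (V : Submodule K (ℕ → K))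
    [FiniteDimensional K V] : ∃ n : ℕ, ∀ v ∈ V, (∀ i < n, v i = 0) → v = 0 := by
  let W : ℕ →o (Submodule K V)ᵒᵈ :=
    { toFun := fun n ↦ OrderDual.toDual
        (⨅ i : Fin n, LinearMap.ker ((LinearMap.proj (i : ℕ)).comp V.subtype))
      monotone' := fun m n hmn ↦ by
        refine OrderDual.toDual_le_toDual.mpr fun v hv ↦ ?_
        simp only [Submodule.mem_iInf, LinearMap.mem_ker] at hv ⊢
        exact fun i ↦ hv ⟨i, i.2.trans_le hmn⟩ }
  have mem_W (n : ℕ) (v : V) :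
      v ∈ OrderDual.ofDual (W n) ↔ ∀ i < n, (v : ℕ → K) i = 0 := by
    simp [W, Fin.forall_iff]
  obtain ⟨n, hn⟩ := IsArtinian.monotone_stabilizes W
  refine ⟨n, fun v hv h ↦ funext fun j ↦ ?_⟩
  have h1 := (mem_W n ⟨v, hv⟩).mpr h
  rw [hn (max n (j + 1)) (le_max_left _ _)] at h1
  exact (mem_W _ _).mp h1 j (by omega)

lemma isNoetherian_integerPoints {K : Type*} [Field K] [CharZero K] (V : Submodule K (ℕ → K))
    [FiniteDimensional K V] : IsNoetherian ℤ (integerPoints V) := by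
  obtain ⟨n, hn⟩ := exists_forall_lt_eq_zero_imp_eq_zero V
  let r : integerPoints V →ₗ[ℤ] (Fin n → ℤ) :=
    (LinearMap.funLeft ℤ ℤ ((↑) : Fin n → ℕ)).comp (integerPoints V).subtype
  refine isNoetherian_of_injective r
    ((injective_iff_map_eq_zero r).mpr fun f hf ↦ Subtype.ext ?_)
  have h := hn _ f.2 fun i hi ↦ by
    simpa [r, LinearMap.funLeft_apply] using congrFun hf ⟨i, hi⟩
  funext a
  simpa using congrFun h a

/-- Integer-valued functions independent over `ℤ` are independent over any field of
characteristic zero. -/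
lemma LinearIndependent.intCastFun {K : Type*} [Field K] [CharZero K] {α ι : Type*} [Finite ι]
    {b : ι → α → ℤ} (hb : LinearIndependent ℤ b) :
    LinearIndependent K fun i ↦ intCastFun K α (b i) := by
  have := Fintype.ofFinite ι
  have hQ : LinearIndependent ℚ fun i ↦ _root_.intCastFun ℚ α (b i) := by
    rw [← LinearIndependent.iff_fractionRing ℤ ℚ]
    refine hb.map' _ (LinearMap.ker_eq_bot.mpr fun f g h ↦ funext fun a ↦ ?_)
    simpa using congrFun h a
  rw [Fintype.linearIndependent_iff] at hQ ⊢
  intro z hz i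
  rw [← Module.forall_dual_apply_eq_zero_iff ℚ]
  intro φ
  refine hQ (fun i ↦ φ (z i)) (funext fun a ↦ ?_) i
  have h := congrArg φ (congrFun hz a)
  simpa [mul_comm (_ : K) (Int.cast _), mul_comm (_ : ℚ) (Int.cast _), ← zsmul_eq_mul] using h

/-- A basis of the integer points stays independent modulo a prime. -/
lemma linearIndependent_zmod_of_basis_integerPoints {K : Type*} [Field K] [CharZero K]
    {α ι : Type*} [Finite ι] {V : Submodule K (α → K)} (b : Module.Basis ι ℤ (integerPoints V))
    (p : ℕ) [NeZero p] :
    LinearIndependent (ZMod p) fun i ↦ intCastFun (ZMod p) α (b i) := by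
  have := Fintype.ofFinite ι
  rw [Fintype.linearIndependent_iff]
  intro z hz
  choose c hc using fun i ↦ ZMod.intCast_surjective (z i)
  have hdvd (a : α) : (p : ℤ) ∣ ∑ i, c i * (b i : α → ℤ) a := by
    rw [← ZMod.intCast_zmod_eq_zero_iff_dvd]
    simpa [hc] using congrFun hz a
  choose g hg using hdvd
  have hp : (p : ℤ) ≠ 0 := Nat.cast_ne_zero.mpr (NeZero.ne p)
  have hsum : (p : ℤ) • g = ((∑ i, c i • b i : integerPoints V) : α → ℤ) := by
    funext a
    simp [hg]
  have hmem : g ∈ integerPoints V := mem_integerPoints_of_smul_mem hp (hsum ▸ Subtype.prop _)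
  have hrepr : ∑ i, c i • b i = (p : ℤ) • (⟨g, hmem⟩ : integerPoints V) := Subtype.ext hsum.symm
  intro i
  rw [← hc i, ZMod.intCast_zmod_eq_zero_iff_dvd]
  have h := congrArg (fun x ↦ b.repr x i) hrepr
  rw [b.repr_sum_self, map_smul, Finsupp.smul_apply, smul_eq_mul] at h
  exact ⟨_, h⟩

/-- The span of the image of a `ℤ`-submodule is the span of the image of a basis. -/
lemma span_intCastFun_basis (R : Type*) [Ring R] {α ι : Type*} {L : Submodule ℤ (α → ℤ)}
    (b : Module.Basis ι ℤ L) :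
    Submodule.span R (Set.range fun i ↦ intCastFun R α (b i)) =
      Submodule.span R (intCastFun R α '' L) := by
  apply le_antisymm
  · refine Submodule.span_mono ?_
    rintro _ ⟨i, rfl⟩
    exact ⟨_, (b i).2, rfl⟩
  · rw [Submodule.span_le]
    rintro _ ⟨f, hf, rfl⟩
    let T := ((Submodule.span R (Set.range fun i ↦ intCastFun R α (b i))).restrictScalars
      ℤ).comap ((intCastFun R α).comp L.subtype)
    have hT : T = ⊤ := by
      rw [eq_top_iff, ← b.span_eq, Submodule.span_le]
      rintro _ ⟨i, rfl⟩
      exact Submodule.subset_span ⟨i, rfl⟩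
    exact (hT ▸ Submodule.mem_top : (⟨f, hf⟩ : L) ∈ T)


/-- Let `p` be a prime and `V ⊆ ℂ^ℕ` a finite-dimensional ℂ-subspace
spanned by its integer points.  Let `Vp ⊆ 𝔽_p^ℕ` be the image of `V ∩ ℤ^ℕ` under
coordinatewise reduction modulo `p`.  Then `dim_{𝔽_p} Vp = dim_ℂ V`. -/
theorem finrank_reduction_eq_finrank
    (p : ℕ) (hp : p.Prime)
    (V : Submodule ℂ (ℕ → ℂ)) (hVfin : FiniteDimensional ℂ V)
    (hVspan : V = Submodule.span ℂ
      {v : ℕ → ℂ | v ∈ V ∧ ∀ n : ℕ, ∃ m : ℤ, v n = (m : ℂ)})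
    (Vp : Submodule (ZMod p) (ℕ → ZMod p))
    (hVp : (Vp : Set (ℕ → ZMod p)) =
      {w : ℕ → ZMod p | ∃ f : ℕ → ℤ,
        (fun n : ℕ => (f n : ℂ)) ∈ V ∧ w = fun n : ℕ => ((f n : ZMod p))}) :
    Module.finrank (ZMod p) Vp = Module.finrank ℂ V := by
  have : Fact p.Prime := ⟨hp⟩
  have := isNoetherian_integerPoints V
  let b := Module.Free.chooseBasis ℤ (integerPoints V)
  have hV : V = Submodule.span ℂ (intCastFun ℂ ℕ '' integerPoints V) := by
    refine hVspan.trans (congrArg _ (Set.ext fun v ↦ ⟨?_, ?_⟩))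
    · rintro ⟨hv, hint⟩
      choose f hf using hint
      obtain rfl : v = intCastFun ℂ ℕ f := funext hf
      exact ⟨f, hv, rfl⟩
    · rintro ⟨f, hf, rfl⟩
      exact ⟨hf, fun n ↦ ⟨f n, rfl⟩⟩
  have hVp' : Vp = Submodule.span (ZMod p) (intCastFun (ZMod p) ℕ '' integerPoints V) := by
    rw [← Vp.span_eq, hVp]
    refine congrArg _ (Set.ext fun w ↦ ⟨?_, ?_⟩)
    · rintro ⟨f, hf, rfl⟩
      exact ⟨f, hf, rfl⟩
    · rintro ⟨f, hf, rfl⟩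
      exact ⟨f, hf, rfl⟩
  have hC : LinearIndependent ℂ fun i ↦ intCastFun ℂ ℕ (b i) :=
    (b.linearIndependent.map' _ (integerPoints V).ker_subtype).intCastFun
  have hF := linearIndependent_zmod_of_basis_integerPoints b p
  have hdim := finrank_span_eq_card hC
  rw [span_intCastFun_basis, ← hV] at hdim
  rw [hdim, hVp', ← span_intCastFun_basis _ b, finrank_span_eq_card hF]
end

section
/- Let p be a prime, let V ⊆ ℂ^ℕ be a finite-dimensional ℂ-subspace spanned by its integer points, let V_p ⊆ 𝔽_p^ℕ be the image of V ∩ ℤ^ℕ under coordinatewise reduction modulo p, and let S ⊆ ℕ with restriction maps π_S : ℂ^ℕ → ℂ^S and π̄_S : 𝔽_p^ℕ → 𝔽_p^S. If V_p ∩ ker π̄_S = 0, then V ∩ ker π_S = 0. -/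
/-- If `V` is spanned by integer points, then applying a `ℚ`-linear functional coordinatewise to an
element of `V` gives, up to a positive integer factor, an integer point of `V`. -/
theorem exists_int_point_of_rat_functional (V : Submodule ℂ (ℕ → ℂ)) {v : ℕ → ℂ}
    (hv : v ∈ Submodule.span ℂ
      {v : ℕ → ℂ | v ∈ V ∧ ∀ n : ℕ, ∃ m : ℤ, v n = (m : ℂ)})
    (φ : ℂ →ₗ[ℚ] ℚ) :
    ∃ N : ℕ, N ≠ 0 ∧ ∃ f : ℕ → ℤ, (fun n => (f n : ℂ)) ∈ V ∧ ∀ n, (f n : ℚ) = N * φ (v n) := by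
  induction hv using Submodule.span_induction generalizing φ with
  | mem v hv =>
    obtain ⟨hvV, hint⟩ := hv
    choose m hm using hint
    refine ⟨(φ 1).den, (φ 1).den_nz, fun n => (φ 1).num * m n, ?_, fun n => ?_⟩
    · convert V.smul_mem ((φ 1).num : ℂ) hvV using 1
      ext n
      simp [hm]
    · have h : φ (v n) = m n * φ 1 := by
        rw [hm, ← smul_eq_mul, Int.cast_smul_eq_zsmul, ← map_zsmul, zsmul_one]
      have h' := Rat.den_mul_eq_num (φ 1)
      rw [h]
      push_cast
      rw [← h']
      ring
  | zero =>
    refine ⟨1, one_ne_zero, 0, ?_, by simp⟩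
    simp only [Pi.zero_apply, Int.cast_zero]
    exact V.zero_mem
  | add v w _ _ ihv ihw =>
    obtain ⟨M, hM, f, hf, hfM⟩ := ihv φ
    obtain ⟨N, hN, g, hg, hgN⟩ := ihw φ
    refine ⟨M * N, mul_ne_zero hM hN, fun n => N * f n + M * g n, ?_, fun n => ?_⟩
    · convert V.add_mem (V.smul_mem (N : ℂ) hf) (V.smul_mem (M : ℂ) hg) using 1
      ext n
      simp
    · push_cast
      rw [hfM, hgN, Pi.add_apply, map_add]
      ring
  | smul c v _ ih =>
    obtain ⟨N, hN, f, hf, hfN⟩ := ih (φ ∘ₗ LinearMap.mulLeft ℚ c)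
    exact ⟨N, hN, f, hf, fun n => by simpa using hfN n⟩

/-- Let `p` be a prime, `V ⊆ ℂ^ℕ` a finite-dimensional ℂ-subspace
spanned by its integer points, `Vp ⊆ 𝔽_p^ℕ` the image of `V ∩ ℤ^ℕ` under
coordinatewise reduction modulo `p`, and `S ⊆ ℕ`.  If `Vp ∩ ker π̄_S = 0`, then
`V ∩ ker π_S = 0`. -/
theorem inf_ker_eq_bot_of_reduction_inf_ker_eq_bot
    (p : ℕ) (hp : p.Prime)
    (V : Submodule ℂ (ℕ → ℂ)) (hVfin : FiniteDimensional ℂ V)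
    (hVspan : V = Submodule.span ℂ
      {v : ℕ → ℂ | v ∈ V ∧ ∀ n : ℕ, ∃ m : ℤ, v n = (m : ℂ)})
    (Vp : Submodule (ZMod p) (ℕ → ZMod p))
    (hVp : (Vp : Set (ℕ → ZMod p)) =
      {w : ℕ → ZMod p | ∃ f : ℕ → ℤ,
        (fun n : ℕ => (f n : ℂ)) ∈ V ∧ w = fun n : ℕ => ((f n : ZMod p))})
    (S : Set ℕ)
    (hbot : Vp ⊓ LinearMap.ker (LinearMap.funLeft (ZMod p) (ZMod p) ((↑) : S → ℕ)) = ⊥) :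
    V ⊓ LinearMap.ker (LinearMap.funLeft ℂ ℂ ((↑) : S → ℕ)) = ⊥ := by
  have hdvd : ∀ f : ℕ → ℤ, (fun n => (f n : ℂ)) ∈ V → (∀ n ∈ S, f n = 0) →
      ∀ n, (p : ℤ) ∣ f n := by
    intro f hf hfS n
    have hmem : (fun n => (f n : ZMod p)) ∈ Vp := by
      rw [← SetLike.mem_coe, hVp]
      exact ⟨f, hf, rfl⟩
    have hker : (fun n => (f n : ZMod p)) ∈ Vp ⊓
        LinearMap.ker (LinearMap.funLeft (ZMod p) (ZMod p) ((↑) : S → ℕ)) := by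
      refine ⟨hmem, LinearMap.mem_ker.2 (funext fun s => ?_)⟩
      simp [LinearMap.funLeft_apply, hfS s s.2]
    rw [hbot, Submodule.mem_bot] at hker
    exact (ZMod.intCast_zmod_eq_zero_iff_dvd _ _).1 (congrFun hker n)
  have hpow : ∀ (k : ℕ) (f : ℕ → ℤ), (fun n => (f n : ℂ)) ∈ V → (∀ n ∈ S, f n = 0) →
      ∀ n, (p : ℤ) ^ k ∣ f n := by
    intro k
    induction k with
    | zero => simp
    | succ k ih =>
      intro f hf hfS n
      choose g hg using hdvd f hf hfS
      have hgV : (fun n => (g n : ℂ)) ∈ V := by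
        convert V.smul_mem (p : ℂ)⁻¹ hf using 1
        ext n
        have : (p : ℂ) ≠ 0 := Nat.cast_ne_zero.2 hp.ne_zero
        simp [hg n, this]
      have hgS : ∀ n ∈ S, g n = 0 := fun n hn => by
        simpa [hg n, hp.ne_zero] using hfS n hn
      rw [hg n, pow_succ']
      exact mul_dvd_mul_left _ (ih g hgV hgS n)
  have hzero : ∀ f : ℕ → ℤ, (fun n => (f n : ℂ)) ∈ V → (∀ n ∈ S, f n = 0) → f = 0 := by
    intro f hf hfS
    ext n
    refine Int.eq_zero_of_abs_lt_dvd (hpow (f n).natAbs f hf hfS n) ?_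
    rw [Int.abs_eq_natAbs]
    exact_mod_cast Nat.lt_pow_self hp.one_lt
  refine (Submodule.eq_bot_iff _).2 fun v ⟨hvV, hvS⟩ => funext fun n => ?_
  refine (Module.forall_dual_apply_eq_zero_iff ℚ (v n)).1 fun φ => ?_
  obtain ⟨N, hN, f, hf, hfN⟩ := exists_int_point_of_rat_functional V (hVspan ▸ hvV) φ
  have hfS : ∀ s ∈ S, f s = 0 := fun s hs => by
    have h : v s = 0 := congrFun (LinearMap.mem_ker.1 hvS) ⟨s, hs⟩
    simpa [h] using hfN s
  simpa [hzero f hf hfS, hN] using hfN n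
end
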